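/- Let d ≥ 2 and let G be a connected finite simple graph on the vertex set {1, …, d}. Then the origin 0 ∈ ℝ^d belongs to the relative interior (intrinsic interior) of the symmetric edge polytope P_G^±, and 0 is the only point of ℤ^d in the relative interior of P_G^±; that is, P_G^± is a Fano polytope of dimension d−1 in the hyperplane x_1 + ⋯ + x_d = 0. -/

import Mathlib

/-- The symmetric edge polytope `P_G^± = conv{±(e_i - e_j) : {i,j} ∈ E(G)}`
of a finite simple graph `G` on the vertex set `Fin d`. -/
noncomputable def symEdgePolytope (d : ℕ) (G : SimpleGraph (Fin d)) : Set (Fin d → ℝ) :=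
  convexHull ℝ {x : Fin d → ℝ |
    ∃ i j : Fin d, G.Adj i j ∧ x = Pi.single i (1 : ℝ) - Pi.single j (1 : ℝ)}

theorem mem_intrinsicInterior_iff_mem_nhdsWithin {E : Type*} [NormedAddCommGroup E]
    [NormedSpace ℝ E] {s : Set E} {x : E} :
    x ∈ intrinsicInterior ℝ s ↔
      x ∈ affineSpan ℝ s ∧ s ∈ nhdsWithin x (affineSpan ℝ s : Set E) := by
  rw [mem_intrinsicInterior]
  constructor
  · rintro ⟨y, hy, rfl⟩
    exact ⟨y.2, preimage_coe_mem_nhds_subtype.1 (mem_interior_iff_mem_nhds.1 hy)⟩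
  · rintro ⟨hx, hs⟩
    exact ⟨⟨x, hx⟩, mem_interior_iff_mem_nhds.2 (preimage_coe_mem_nhds_subtype.2 hs), rfl⟩

theorem Convex.zero_mem_intrinsicInterior {E : Type*} [NormedAddCommGroup E]
    [NormedSpace ℝ E] [FiniteDimensional ℝ E] {s : Set E} (hs : Convex ℝ s)
    (hne : s.Nonempty) (hneg : ∀ x ∈ s, -x ∈ s) : (0 : E) ∈ intrinsicInterior ℝ s := by
  obtain ⟨x, hx⟩ := hne.intrinsicInterior hs
  have hxs := intrinsicInterior_subset hx
  have h0 : (0 : E) ∈ s := by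
    have h := hs hxs (hneg x hxs) (a := 1 / 2) (b := 1 / 2)
      (by norm_num) (by norm_num) (by norm_num)
    simpa using h
  have h0A := subset_affineSpan ℝ s h0
  rw [mem_intrinsicInterior_iff_mem_nhdsWithin] at hx ⊢
  refine ⟨h0A, ?_⟩
  have hmap : Filter.Tendsto (fun z : E ↦ (2 : ℝ) • z + x)
      (nhdsWithin 0 (affineSpan ℝ s : Set E)) (nhdsWithin x (affineSpan ℝ s : Set E)) := by
    refine tendsto_nhdsWithin_iff.2 ⟨?_, ?_⟩
    · have hc : Continuous (fun z : E ↦ (2 : ℝ) • z + x) := by fun_prop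
      simpa using (hc.tendsto 0).mono_left nhdsWithin_le_nhds
    · filter_upwards [self_mem_nhdsWithin] with z hz
      simpa using (affineSpan ℝ s).smul_vsub_vadd_mem 2 hz h0A hx.1
  filter_upwards [hmap hx.2] with z hz
  have h := hs hz (hneg x hxs) (a := 1 / 2) (b := 1 / 2)
    (by norm_num) (by norm_num) (by norm_num)
  have e : (1 / 2 : ℝ) • ((2 : ℝ) • z + x) + (1 / 2 : ℝ) • (-x) = z := by module
  rwa [e] at h

theorem exists_one_lt_smul_mem_of_mem_intrinsicInterior {E : Type*} [NormedAddCommGroup E]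
    [NormedSpace ℝ E] {s : Set E} {x : E} (h0 : (0 : E) ∈ affineSpan ℝ s)
    (hx : x ∈ intrinsicInterior ℝ s) : ∃ t : ℝ, 1 < t ∧ t • x ∈ s := by
  rw [mem_intrinsicInterior_iff_mem_nhdsWithin] at hx
  have hmap : Filter.Tendsto (fun t : ℝ ↦ t • x) (nhds 1)
      (nhdsWithin x (affineSpan ℝ s : Set E)) := by
    refine tendsto_nhdsWithin_iff.2 ⟨?_, ?_⟩
    · have hc : Continuous (fun t : ℝ ↦ t • x) := by fun_prop
      simpa using hc.tendsto 1
    · refine Filter.Eventually.of_forall fun t ↦ ?_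
      simpa using (affineSpan ℝ s).smul_vsub_vadd_mem t hx.1 h0 h0
  have hev : ∀ᶠ t in nhdsWithin (1 : ℝ) (Set.Ioi 1), t • x ∈ s :=
    nhdsWithin_le_nhds (hmap hx.2)
  have hgt : ∀ᶠ t in nhdsWithin (1 : ℝ) (Set.Ioi 1), 1 < t := self_mem_nhdsWithin
  exact (hgt.and hev).exists

theorem neg_mem_symEdgePolytope {d : ℕ} {G : SimpleGraph (Fin d)} {x : Fin d → ℝ}
    (hx : x ∈ symEdgePolytope d G) : -x ∈ symEdgePolytope d G := by
  have hsub : symEdgePolytope d G ⊆ -symEdgePolytope d G := by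
    refine convexHull_min ?_ (convex_convexHull ℝ _).neg
    rintro _ ⟨i, j, hij, rfl⟩
    exact subset_convexHull ℝ _ ⟨j, i, hij.symm, by simp⟩
  exact hsub hx

theorem symEdgePolytope_nonempty {d : ℕ} {G : SimpleGraph (Fin d)} (hd : 2 ≤ d)
    (hG : G.Connected) : (symEdgePolytope d G).Nonempty := by
  have : Nontrivial (Fin d) := Fin.nontrivial_iff_two_le.2 hd
  obtain ⟨i, j, hij⟩ := exists_pair_ne (Fin d)
  obtain ⟨w⟩ := hG.preconnected i j
  cases w with
  | nil => exact absurd rfl hij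
  | cons h _ => exact ⟨_, subset_convexHull ℝ _ ⟨_, _, h, rfl⟩⟩

theorem sum_eq_zero_of_mem_symEdgePolytope {d : ℕ} {G : SimpleGraph (Fin d)} {x : Fin d → ℝ}
    (hx : x ∈ symEdgePolytope d G) : ∑ i, x i = 0 := by
  have hlin : IsLinearMap ℝ fun y : Fin d → ℝ ↦ ∑ i, y i :=
    ⟨fun y z ↦ by simp [Finset.sum_add_distrib], fun c y ↦ by simp [Finset.mul_sum]⟩
  refine convexHull_min ?_ (convex_hyperplane hlin 0) hx
  rintro _ ⟨i, j, -, rfl⟩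
  simp

theorem sub_le_two_of_mem_symEdgePolytope {d : ℕ} {G : SimpleGraph (Fin d)} {x : Fin d → ℝ}
    (hx : x ∈ symEdgePolytope d G) (i j : Fin d) : x i - x j ≤ 2 := by
  have hlin : IsLinearMap ℝ fun y : Fin d → ℝ ↦ y i - y j :=
    ⟨fun y z ↦ by simp; ring, fun c y ↦ by simp; ring⟩
  refine convexHull_min ?_ (convex_halfSpace_le hlin 2) hx
  rintro _ ⟨a, b, -, rfl⟩
  simp only [Set.mem_ofPred_eq, Pi.sub_apply, Pi.single_apply]
  split_ifs <;> norm_num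

/-- For a connected simple graph `G` on `d ≥ 2` vertices, the
origin lies in the relative (intrinsic) interior of `P_G^±`, and it is the
unique lattice point of `ℤ^d` in the relative interior; i.e., `P_G^±` is a
Fano polytope. -/
theorem stmt15 (d : ℕ) (hd : 2 ≤ d) (G : SimpleGraph (Fin d)) (hG : G.Connected) :
    (0 : Fin d → ℝ) ∈ intrinsicInterior ℝ (symEdgePolytope d G) ∧
    ∀ x ∈ intrinsicInterior ℝ (symEdgePolytope d G),
      (∀ i : Fin d, ∃ n : ℤ, x i = (n : ℝ)) → x = 0 := by
  have h0 := (convex_convexHull ℝ _).zero_mem_intrinsicInterior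
    (symEdgePolytope_nonempty hd hG) fun _ ↦ neg_mem_symEdgePolytope
  refine ⟨h0, fun x hx hint ↦ ?_⟩
  by_contra hne
  obtain ⟨k, hk⟩ := Function.ne_iff.1 hne
  have hsum := sum_eq_zero_of_mem_symEdgePolytope (intrinsicInterior_subset hx)
  obtain ⟨i, -, hi⟩ := Finset.exists_pos_of_sum_zero_of_exists_nonzero x hsum
    ⟨k, Finset.mem_univ k, hk⟩
  obtain ⟨j, -, hj⟩ := Finset.exists_pos_of_sum_zero_of_exists_nonzero (-x) (by simp [hsum])
    ⟨k, Finset.mem_univ k, by simpa using hk⟩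
  obtain ⟨t, ht, htx⟩ := exists_one_lt_smul_mem_of_mem_intrinsicInterior
    (subset_affineSpan ℝ _ (intrinsicInterior_subset h0)) hx
  have hle := sub_le_two_of_mem_symEdgePolytope htx i j
  obtain ⟨m, hm⟩ := hint i
  obtain ⟨n, hn⟩ := hint j
  simp only [Pi.neg_apply, Pi.smul_apply, smul_eq_mul, hm, hn] at hi hj hle
  have hm1 : (1 : ℝ) ≤ m := by exact_mod_cast Int.cast_pos.1 hi
  have hn1 : (n : ℝ) ≤ -1 := by
    have : n < 0 := by exact_mod_cast neg_pos.1 hj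
    exact_mod_cast (by omega : n ≤ -1)
  nlinarith
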